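/- Let n ≥ 2, r ∈ (0, π/4), p ∈ Sⁿ and q = −p. Let a, z ∈ Sⁿ with z·a < 0. If ∫_{B_{p,r}} g(z·F_a(v)) π_z(F_a(v)) dv = 0 and ∫_{B_{q,r}} g(z·F_a(v)) π_z(F_a(v)) dv = 0, then {z, R_a(z)} = {p, q}. -/

import Mathlib

open MeasureTheory Real
open scoped RealInnerProductSpace

noncomputable section

/-- The unit sphere `Sⁿ ⊆ ℝ^{n+1}`. -/
def sph (n : ℕ) : Set (EuclideanSpace ℝ (Fin (n + 1))) := Metric.sphere 0 1

/-- Reflection `R_a(z) = z - 2(z·a)a` across the hyperplane `a^⊥`. -/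
def sphRefl (n : ℕ) (a z : EuclideanSpace ℝ (Fin (n + 1))) : EuclideanSpace ℝ (Fin (n + 1)) :=
  z - (2 * ⟪z, a⟫) • a

/-- The folding map `F_a` : reflect the open half-sphere `{z·a > 0}` onto `{z·a < 0}`. -/
def fold (n : ℕ) (a z : EuclideanSpace ℝ (Fin (n + 1))) : EuclideanSpace ℝ (Fin (n + 1)) :=
  if 0 < ⟪z, a⟫ then sphRefl n a z else z

/-- Projection `π_z(w) = w - (w·z)z` onto the tangent space `z^⊥`. -/
def proj (n : ℕ) (z w : EuclideanSpace ℝ (Fin (n + 1))) : EuclideanSpace ℝ (Fin (n + 1)) :=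
  w - ⟪w, z⟫ • z

/-- The open geodesic ball `B_{p,r}` on the unit sphere: points of the sphere at geodesic
(angular) distance `arccos (p·v) < r` from `p`. -/
def gball (n : ℕ) (p : EuclideanSpace ℝ (Fin (n + 1))) (r : ℝ) :
    Set (EuclideanSpace ℝ (Fin (n + 1))) :=
  {v | v ∈ sph n ∧ Real.arccos ⟪p, v⟫ < r}

/-- `G(t) = ∫₀ᵗ g(s) ds`. -/
def Gfun (g : ℝ → ℝ) (t : ℝ) : ℝ := ∫ s in (0:ℝ)..t, g s

lemma hemi_fin (n : ℕ) (v : EuclideanSpace ℝ (Fin (n + 1))) (hv : ‖v‖ = 1) :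
    μH[(n:ℝ)] {x : EuclideanSpace ℝ (Fin (n + 1)) | x ∈ sph n ∧ ⟪v, x⟫ ≤ 0} < ⊤ := by
  have : Fact (Module.finrank ℝ (EuclideanSpace ℝ (Fin (n + 1))) = n + 1) := ⟨by simp⟩
  have hv0 : v ≠ 0 := by rintro rfl; simp at hv
  have hfr : Module.finrank ℝ (ℝ ∙ v)ᗮ = n := Submodule.finrank_orthogonal_span_singleton hv0
  let f : (ℝ ∙ v)ᗮ → EuclideanSpace ℝ (Fin (n + 1)) := fun w => stereoInvFunAux v (w : EuclideanSpace ℝ (Fin (n + 1)))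
  have hf : ContDiff ℝ 1 f := contDiff_stereoInvFunAux.comp (ℝ ∙ v)ᗮ.subtypeL.contDiff
  obtain ⟨K, hK⟩ := (hf.locallyLipschitz.locallyLipschitzOn (s := Metric.closedBall 0 2)).exists_lipschitzOnWith_of_compact
    (isCompact_closedBall (0 : (ℝ ∙ v)ᗮ) 2)
  have h1 := hK.hausdorffMeasure_image_le (d := (n:ℝ)) (by positivity)
  have hHaar := MeasureTheory.isAddHaarMeasure_hausdorffMeasure (E := (ℝ ∙ v)ᗮ)
  rw [hfr] at hHaar
  have h2 : μH[(n:ℝ)] (Metric.closedBall (0 : (ℝ ∙ v)ᗮ) 2) < ⊤ :=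
    (isCompact_closedBall (0 : (ℝ ∙ v)ᗮ) 2).measure_lt_top
  refine lt_of_le_of_lt (measure_mono ?_) (lt_of_le_of_lt h1 (ENNReal.mul_lt_top (by simp) h2))
  rintro x ⟨hx, hvx⟩
  have hxv : x ≠ v := by
    rintro rfl
    rw [real_inner_self_eq_norm_sq, hv] at hvx
    norm_num at hvx
  refine ⟨stereoToFun v x, ?_, ?_⟩
  · have hx1 : ‖x‖ = 1 := by simpa [sph] using hx
    rw [mem_closedBall_zero_iff, stereoToFun_apply, norm_smul]
    have h3 : ‖(ℝ ∙ v)ᗮ.orthogonalProjectionOnto x‖ ≤ 1 := by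
      have := (ℝ ∙ v)ᗮ.norm_orthogonalProjectionOnto_apply_le x
      rwa [hx1] at this
    have h4 : ‖2 / ((1 : ℝ) - innerSL ℝ v x)‖ ≤ 2 := by
      rw [innerSL_apply_apply, Real.norm_eq_abs, abs_of_nonneg (by apply div_nonneg <;> linarith)]
      rw [div_le_iff₀ (by linarith)]
      linarith
    nlinarith [norm_nonneg ((ℝ ∙ v)ᗮ.orthogonalProjectionOnto x)]
  · have := stereo_left_inv hv (x := ⟨x, hx⟩) hxv
    exact congrArg Subtype.val this

lemma sph_fin (n : ℕ) : μH[(n:ℝ)] (sph n) < ⊤ := by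
  obtain ⟨v, hv⟩ := exists_norm_eq (EuclideanSpace ℝ (Fin (n + 1))) zero_le_one
  refine lt_of_le_of_lt (measure_mono ?_) (measure_union_lt_top (hemi_fin n v hv) (hemi_fin n (-v) (by simpa using hv)))
  intro x hx
  rcases le_total ⟪v, x⟫ 0 with h | h
  · exact Or.inl ⟨hx, h⟩
  · exact Or.inr ⟨hx, by simpa using h⟩

lemma sph_open_pos (n : ℕ) (U : Set (EuclideanSpace ℝ (Fin (n + 1)))) (hU : IsOpen U)
    (v : EuclideanSpace ℝ (Fin (n + 1))) (hvU : v ∈ U) (hvs : v ∈ sph n) :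
    0 < μH[(n:ℝ)] (U ∩ sph n) := by
  have hv : ‖v‖ = 1 := by simpa [sph] using hvs
  have : Fact (Module.finrank ℝ (EuclideanSpace ℝ (Fin (n + 1))) = n + 1) := ⟨by simp⟩
  have hv0 : v ≠ 0 := by rintro rfl; simp at hv
  have hfr : Module.finrank ℝ (ℝ ∙ v)ᗮ = n := Submodule.finrank_orthogonal_span_singleton hv0
  have hHaar := MeasureTheory.isAddHaarMeasure_hausdorffMeasure (E := (ℝ ∙ v)ᗮ)
  rw [hfr] at hHaar
  let f : (ℝ ∙ v)ᗮ → EuclideanSpace ℝ (Fin (n + 1)) :=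
    fun w => (w : EuclideanSpace ℝ (Fin (n + 1))) + √(1 - ‖w‖ ^ 2) • v
  have hf : Continuous f := by fun_prop
  let V : Set (ℝ ∙ v)ᗮ := f ⁻¹' U ∩ Metric.ball 0 1
  have hV : IsOpen V := (hU.preimage hf).inter Metric.isOpen_ball
  have h0 : (0 : (ℝ ∙ v)ᗮ) ∈ V := ⟨by simpa [f] using hvU, by simp⟩
  have hpos : 0 < μH[(n:ℝ)] V := hV.measure_pos _ ⟨0, h0⟩
  have hL : LipschitzWith 1 (ℝ ∙ v)ᗮ.orthogonalProjectionOnto :=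
    (ℝ ∙ v)ᗮ.lipschitzWith_orthogonalProjectionOnto
  have h1 := hL.hausdorffMeasure_image_le (d := (n:ℝ)) (by positivity) (U ∩ sph n)
  simp only [ENNReal.coe_one, ENNReal.one_rpow, one_mul] at h1
  refine lt_of_lt_of_le hpos (le_trans (measure_mono ?_) h1)
  rintro w ⟨hw1, hw2⟩
  have hw3 : ‖w‖ < 1 := by simpa using hw2
  refine ⟨f w, ⟨hw1, ?_⟩, ?_⟩
  · have hvw : ⟪(w : EuclideanSpace ℝ (Fin (n + 1))), v⟫ = 0 := Submodule.mem_orthogonal_singleton_iff_inner_left.mp w.2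
    have : ‖f w‖ ^ 2 = 1 := by
      simp only [f]
      rw [norm_add_sq_real, inner_smul_right, hvw, norm_smul, hv, mul_one, Real.norm_eq_abs, sq_abs,
        Real.sq_sqrt (by nlinarith [norm_nonneg w])]
      simp
    have h2 : ‖f w‖ = 1 := (pow_eq_one_iff_of_nonneg (norm_nonneg _) two_ne_zero).1 this
    simpa [sph] using h2
  · simp [f, Submodule.orthogonalProjectionOnto_orthogonalComplement_singleton_eq_zero]

lemma refl_eq (n : ℕ) (w v : EuclideanSpace ℝ (Fin (n + 1))) (hw : ‖w‖ = 1) :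
    (ℝ ∙ w)ᗮ.reflection v = sphRefl n w v := by
  rw [Submodule.reflection_orthogonal_apply, Submodule.reflection_singleton_apply]
  simp [hw, sphRefl, real_inner_comm]
  module

lemma refl_norm (n : ℕ) (w v : EuclideanSpace ℝ (Fin (n + 1))) (hw : ‖w‖ = 1) :
    ‖sphRefl n w v‖ = ‖v‖ := by
  rw [← refl_eq n w v hw]; simp

lemma refl_sph (n : ℕ) (w v : EuclideanSpace ℝ (Fin (n + 1))) (hw : ‖w‖ = 1) :
    sphRefl n w v ∈ sph n ↔ v ∈ sph n := by
  simp [sph, refl_norm n w v hw]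

lemma refl_refl (n : ℕ) (w v : EuclideanSpace ℝ (Fin (n + 1))) (hw : ‖w‖ = 1) :
    sphRefl n w (sphRefl n w v) = v := by
  rw [← refl_eq n w _ hw, ← refl_eq n w _ hw]; simp

lemma refl_integral (n : ℕ) (w : EuclideanSpace ℝ (Fin (n + 1))) (hw : ‖w‖ = 1)
    (f : EuclideanSpace ℝ (Fin (n + 1)) → ℝ) (s : Set (EuclideanSpace ℝ (Fin (n + 1)))) :
    ∫ v in (sphRefl n w) ⁻¹' s, f (sphRefl n w v) ∂μH[(n:ℝ)] = ∫ v in s, f v ∂μH[(n:ℝ)] := by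
  have h1 := (ℝ ∙ w)ᗮ.reflection.toIsometryEquiv.measurePreserving_hausdorffMeasure (n:ℝ)
  have h2 := h1.setIntegral_preimage_emb
    (ℝ ∙ w)ᗮ.reflection.toIsometryEquiv.toHomeomorph.measurableEmbedding f s
  have h3 : ⇑(ℝ ∙ w)ᗮ.reflection.toIsometryEquiv = sphRefl n w := by
    ext1 v
    exact refl_eq n w v hw
  rwa [h3] at h2

lemma gball_eq (n : ℕ) (c : EuclideanSpace ℝ (Fin (n + 1))) (hc : ‖c‖ = 1) (r : ℝ) (hr0 : 0 < r)
    (hr1 : r < π / 4) : gball n c r = {v | v ∈ sph n ∧ cos r < ⟪c, v⟫} := by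
  ext v
  simp only [gball, Set.mem_ofPred_eq, and_congr_right_iff]
  intro hv
  have hv1 : ‖v‖ = 1 := by simpa [sph] using hv
  have hb := abs_le.1 (abs_real_inner_le_norm c v)
  rw [hc, hv1, mul_one] at hb
  have h1 := Real.strictAntiOn_cos.lt_iff_gt (a := r) (b := arccos ⟪c, v⟫)
    ⟨hr0.le, by linarith [pi_pos]⟩ ⟨arccos_nonneg _, arccos_le_pi _⟩
  rw [Real.cos_arccos hb.1 hb.2] at h1
  exact ⟨fun h => (Real.cos_arccos hb.1 hb.2) ▸ Real.strictAntiOn_cos ⟨arccos_nonneg _, arccos_le_pi _⟩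
    ⟨hr0.le, by linarith [pi_pos]⟩ h, fun h => by
      by_contra hcon
      push Not at hcon
      have := Real.strictAntiOn_cos.antitoneOn ⟨hr0.le, by linarith [pi_pos]⟩
        ⟨arccos_nonneg _, arccos_le_pi _⟩ hcon
      rw [Real.cos_arccos hb.1 hb.2] at this
      linarith⟩

lemma gball_meas (n : ℕ) (c : EuclideanSpace ℝ (Fin (n + 1))) (r : ℝ) :
    MeasurableSet (gball n c r) := by
  have h1 : MeasurableSet (sph n) := Metric.isClosed_sphere.measurableSet
  have h2 : IsOpen {v : EuclideanSpace ℝ (Fin (n + 1)) | Real.arccos ⟪c, v⟫ < r} :=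
    isOpen_lt (Real.continuous_arccos.comp (by fun_prop)) continuous_const
  exact h1.inter h2.measurableSet

lemma refl_inner (n : ℕ) (c w v : EuclideanSpace ℝ (Fin (n + 1))) :
    ⟪c, sphRefl n w v⟫ = ⟪c, v⟫ - 2 * ⟪v, w⟫ * ⟪c, w⟫ := by
  simp [sphRefl, inner_sub_right, inner_smul_right]

lemma refl_inner_self (n : ℕ) (w v : EuclideanSpace ℝ (Fin (n + 1))) (hw : ‖w‖ = 1) :
    ⟪sphRefl n w v, w⟫ = - ⟪v, w⟫ := by
  rw [real_inner_comm, refl_inner, real_inner_self_eq_norm_sq, hw, real_inner_comm]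
  ring

lemma refl_cont (n : ℕ) (w : EuclideanSpace ℝ (Fin (n + 1))) : Continuous (sphRefl n w) := by
  unfold sphRefl; fun_prop

lemma exists_pt (n : ℕ) (hn : 2 ≤ n) (c w : EuclideanSpace ℝ (Fin (n + 1))) (hc : ‖c‖ = 1)
    (hcw : 0 < ⟪c, w⟫) (r : ℝ) (hr0 : 0 < r) (hr1 : r < π / 4) :
    ∃ v ∈ sph n, cos r < ⟪c, v⟫ ∧ ⟪c, sphRefl n w v⟫ < cos r := by
  have : Fact (Module.finrank ℝ (EuclideanSpace ℝ (Fin (n + 1))) = n + 1) := ⟨by simp⟩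
  have hc0 : c ≠ 0 := by rintro rfl; simp at hc
  have hfr : Module.finrank ℝ (ℝ ∙ c)ᗮ = n := Submodule.finrank_orthogonal_span_singleton hc0
  have : Nontrivial (ℝ ∙ c)ᗮ := Module.nontrivial_of_finrank_pos (R := ℝ) (by omega)
  obtain ⟨d0, hd0⟩ := exists_norm_eq (ℝ ∙ c)ᗮ zero_le_one
  have hcd0 : ⟪c, (d0 : EuclideanSpace ℝ (Fin (n + 1)))⟫ = 0 :=
    Submodule.mem_orthogonal_singleton_iff_inner_right.mp d0.2
  have hd0' : ‖(d0 : EuclideanSpace ℝ (Fin (n + 1)))‖ = 1 := hd0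
  obtain ⟨d, hd, hcd, hdw⟩ : ∃ d : EuclideanSpace ℝ (Fin (n + 1)), ‖d‖ = 1 ∧ ⟪c, d⟫ = 0 ∧ 0 ≤ ⟪d, w⟫ := by
    rcases le_total 0 ⟪(d0 : EuclideanSpace ℝ (Fin (n + 1))), w⟫ with h | h
    · exact ⟨d0, hd0', hcd0, h⟩
    · exact ⟨-d0, by simpa using hd0', by simpa using hcd0, by simpa using h⟩
  let γ : ℝ → EuclideanSpace ℝ (Fin (n + 1)) := fun t => cos t • c + sin t • d
  have hγ : Continuous γ := by fun_prop
  have hcγ : ∀ t, ⟪c, γ t⟫ = cos t := fun t => by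
    simp [γ, inner_add_right, inner_smul_right, hcd, hc]
  have hγs : ∀ t, γ t ∈ sph n := fun t => by
    have : ‖γ t‖ ^ 2 = 1 := by
      simp only [γ]
      rw [norm_add_sq_real, norm_smul, norm_smul, hc, hd, inner_smul_left, inner_smul_right, hcd]
      simp
    simpa [sph] using (pow_eq_one_iff_of_nonneg (norm_nonneg _) two_ne_zero).1 this
  have hop : IsOpen {t | ⟪c, sphRefl n w (γ t)⟫ < cos r} :=
    isOpen_lt (by have := (refl_cont n w).comp hγ; exact continuous_const.inner this) continuous_const
  have hcr : 0 < cos r := cos_pos_of_mem_Ioo ⟨by linarith [pi_pos], by linarith [pi_pos]⟩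
  have hsr : 0 < sin r := sin_pos_of_pos_of_lt_pi hr0 (by linarith [pi_pos])
  have hmem : r ∈ {t | ⟪c, sphRefl n w (γ t)⟫ < cos r} := by
    simp only [Set.mem_ofPred_eq, refl_inner, hcγ]
    have : 0 < ⟪γ r, w⟫ := by
      simp only [γ, inner_add_left, inner_smul_left]
      simp only [conj_trivial]
      have := mul_pos hcr hcw
      have := mul_nonneg hsr.le hdw
      linarith
    have := mul_pos this hcw
    linarith
  have h1 : ∀ᶠ t in nhdsWithin r (Set.Iio r), ⟪c, sphRefl n w (γ t)⟫ < cos r :=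
    nhdsWithin_le_nhds (hop.mem_nhds hmem)
  have h2 : ∀ᶠ t in nhdsWithin r (Set.Iio r), t ∈ Set.Ioo 0 r := Ioo_mem_nhdsLT hr0
  obtain ⟨t, ht1, ht2⟩ := (h1.and h2).exists
  refine ⟨γ t, hγs t, ?_, ht1⟩
  rw [hcγ]
  exact Real.strictAntiOn_cos ⟨ht2.1.le, by linarith [pi_pos, ht2.2]⟩ ⟨hr0.le, by linarith [pi_pos]⟩ ht2.2

lemma integ (n : ℕ) {F : Type*} [NormedAddCommGroup F] (h : EuclideanSpace ℝ (Fin (n + 1)) → F)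
    (hm : StronglyMeasurable h) (C : ℝ) (hC : ∀ v ∈ sph n, ‖h v‖ ≤ C) :
    IntegrableOn h (sph n) μH[(n:ℝ)] := by
  refine Measure.integrableOn_of_bounded (M := C) (sph_fin n).ne hm.aestronglyMeasurable ?_
  exact (ae_restrict_iff' Metric.isClosed_sphere.measurableSet).2 (Filter.Eventually.of_forall hC)

lemma keyA (n : ℕ) (hn : 2 ≤ n) (c w : EuclideanSpace ℝ (Fin (n + 1))) (hc : ‖c‖ = 1) (hw : ‖w‖ = 1)
    (hcw : 0 < ⟪c, w⟫) (r : ℝ) (hr0 : 0 < r) (hr1 : r < π / 4)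
    (ψ : EuclideanSpace ℝ (Fin (n + 1)) → ℝ) (hm : Measurable ψ) (C : ℝ)
    (hC : ∀ v ∈ sph n, ψ v ≤ C) (h0 : ∀ v ∈ sph n, 0 ≤ ψ v)
    (hinv : ∀ v ∈ sph n, ψ (sphRefl n w v) = ψ v)
    (hpos : ∀ v ∈ sph n, ⟪v, w⟫ ≠ 0 → 0 < ψ v) :
    ∫ v in gball n c r, ψ v * ⟪v, w⟫ ∂μH[(n:ℝ)] ≠ 0 := by
  intro hzero
  set B := gball n c r with hB
  have hBs : ∀ v ∈ B, v ∈ sph n := fun v hv => hv.1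
  have hBm : MeasurableSet B := gball_meas n c r
  set B' := sphRefl n w ⁻¹' B with hB'
  have hBm' : MeasurableSet B' := hBm.preimage (refl_cont n w).measurable
  have hint : IntegrableOn (fun v => ψ v * ⟪v, w⟫) (sph n) μH[(n:ℝ)] := by
    refine integ n _ (hm.mul (by fun_prop)).stronglyMeasurable C fun v hv => ?_
    have hv1 : ‖v‖ = 1 := by simpa [sph] using hv
    have h1 := abs_real_inner_le_norm v w
    rw [hv1, hw, mul_one] at h1
    rw [Real.norm_eq_abs, abs_mul, abs_of_nonneg (h0 v hv)]
    nlinarith [h0 v hv, hC v hv]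
  have hpre : sphRefl n w ⁻¹' (B ∩ B') = B ∩ B' := by
    ext v
    simp only [hB', Set.mem_preimage, Set.mem_inter_iff, refl_refl n w v hw]
    exact and_comm
  have h1 := refl_integral n w hw (fun v => ψ v * ⟪v, w⟫) (B ∩ B')
  rw [hpre] at h1
  have h2 : ∫ v in B ∩ B', ψ (sphRefl n w v) * ⟪sphRefl n w v, w⟫ ∂μH[(n:ℝ)]
      = ∫ v in B ∩ B', -(ψ v * ⟪v, w⟫) ∂μH[(n:ℝ)] := by
    refine setIntegral_congr_fun (hBm.inter hBm') fun v hv => ?_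
    simp only [refl_inner_self n w v hw, hinv v (hBs v hv.1)]
    ring
  rw [h2, integral_neg] at h1
  have h3 := integral_inter_add_sdiff (μ := μH[(n:ℝ)]) (s := B) (t := B') hBm' (hint.mono_set hBs)
  have h4 : ∫ v in B \ B', ψ v * ⟪v, w⟫ ∂μH[(n:ℝ)] = 0 := by linarith
  have hgt : ∀ v ∈ B \ B', 0 < ⟪v, w⟫ := by
    rintro v ⟨hv, hv'⟩
    rw [hB, gball_eq n c hc r hr0 hr1] at hv
    rw [hB', hB, Set.mem_preimage, gball_eq n c hc r hr0 hr1] at hv'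
    have h5 : ⟪c, sphRefl n w v⟫ ≤ cos r := by
      by_contra hcon
      push Not at hcon
      exact hv' ⟨(refl_sph n w v hw).2 hv.1, hcon⟩
    rw [refl_inner] at h5
    have := hv.2
    by_contra hcon
    push Not at hcon
    nlinarith
  have h5 : 0 < ∫ v in B \ B', ψ v * ⟪v, w⟫ ∂μH[(n:ℝ)] := by
    rw [setIntegral_pos_iff_support_of_nonneg_ae]
    · obtain ⟨v, hv, hv1, hv2⟩ := exists_pt n hn c w hc hcw r hr0 hr1
      have hU : IsOpen ({v | cos r < ⟪c, v⟫} ∩ {v | ⟪c, sphRefl n w v⟫ < cos r}) :=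
        (isOpen_lt continuous_const (by fun_prop)).inter
          (isOpen_lt (continuous_const.inner (refl_cont n w)) continuous_const)
      refine lt_of_lt_of_le (sph_open_pos n _ hU v ⟨hv1, hv2⟩ hv) (measure_mono ?_)
      rintro u ⟨⟨hu1, hu2⟩, hus⟩
      have hmem : u ∈ B \ B' := by
        rw [hB', hB, gball_eq n c hc r hr0 hr1]
        refine ⟨⟨hus, hu1⟩, fun h => ?_⟩
        exact lt_asymm (show ⟪c, sphRefl n w u⟫ < cos r from hu2) h.2
      refine ⟨?_, hmem⟩
      have := hgt u hmem
      exact (mul_pos (hpos u hus this.ne') this).ne'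
    · refine (ae_restrict_iff' (hBm.diff hBm')).2 (Filter.Eventually.of_forall fun v hv => ?_)
      exact mul_nonneg (h0 v (hBs v hv.1)) (hgt v hv).le
    · exact hint.mono_set (fun v hv => hBs v hv.1)
  linarith

lemma fold_inner_orth (n : ℕ) (a v w : EuclideanSpace ℝ (Fin (n + 1))) (h : ⟪w, a⟫ = 0) :
    ⟪fold n a v, w⟫ = ⟪v, w⟫ := by
  unfold fold
  split_ifs
  · rw [real_inner_comm, refl_inner, h, real_inner_comm]; ring
  · rfl

lemma fold_refl (n : ℕ) (a v : EuclideanSpace ℝ (Fin (n + 1))) (ha : ‖a‖ = 1) :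
    fold n a (sphRefl n a v) = fold n a v := by
  unfold fold
  rw [refl_inner_self n a v ha, refl_refl n a v ha]
  split_ifs with h1 h2 h2
  · linarith
  · rfl
  · rfl
  · have : ⟪v, a⟫ = 0 := by linarith
    simp [sphRefl, this]

lemma fold_comm (n : ℕ) (a w v : EuclideanSpace ℝ (Fin (n + 1))) (h : ⟪w, a⟫ = 0) :
    fold n a (sphRefl n w v) = sphRefl n w (fold n a v) := by
  have h' : ⟪a, w⟫ = 0 := by rw [real_inner_comm, h]
  have h1 : ⟪sphRefl n w v, a⟫ = ⟪v, a⟫ := by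
    rw [real_inner_comm, refl_inner, h', real_inner_comm]; ring
  unfold fold
  rw [h1]
  split_ifs
  · have h2 : ⟪sphRefl n a v, w⟫ = ⟪v, w⟫ := by
      rw [real_inner_comm, refl_inner, h, real_inner_comm]; ring
    unfold sphRefl at h1 h2 ⊢
    rw [h1, h2]
    module
  · rfl

lemma fold_norm (n : ℕ) (a v : EuclideanSpace ℝ (Fin (n + 1))) (ha : ‖a‖ = 1) :
    ‖fold n a v‖ = ‖v‖ := by
  unfold fold
  split_ifs
  · exact refl_norm n a v ha
  · rfl

lemma fold_nonpos (n : ℕ) (a v : EuclideanSpace ℝ (Fin (n + 1))) (ha : ‖a‖ = 1) :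
    ⟪fold n a v, a⟫ ≤ 0 := by
  unfold fold
  split_ifs with h
  · rw [refl_inner_self n a v ha]; linarith
  · linarith

lemma fold_meas (n : ℕ) (a : EuclideanSpace ℝ (Fin (n + 1))) : Measurable (fold n a) := by
  unfold fold
  exact Measurable.ite (isOpen_lt continuous_const (by fun_prop)).measurableSet
    (refl_cont n a).measurable measurable_id

def clampg (g : ℝ → ℝ) (t : ℝ) : ℝ := g (max (-1) (min 1 t))

lemma clamp_mem (t : ℝ) : max (-1) (min 1 t) ∈ Set.Icc (-1:ℝ) 1 :=
  ⟨le_max_left _ _, max_le (by norm_num) (min_le_left _ _)⟩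

lemma clampg_eq (g : ℝ → ℝ) (t : ℝ) (h1 : -1 ≤ t) (h2 : t ≤ 1) : clampg g t = g t := by
  rw [clampg, min_eq_right h2, max_eq_right h1]

lemma clampg_cont (g : ℝ → ℝ) (hg : ContinuousOn g (Set.Icc (-1) 1)) : Continuous (clampg g) :=
  hg.comp_continuous (by fun_prop) clamp_mem

lemma clampg_bdd (g : ℝ → ℝ) (hg : ContinuousOn g (Set.Icc (-1) 1)) : ∃ C, ∀ t, clampg g t ≤ C := by
  obtain ⟨C, hC⟩ := isCompact_Icc.exists_bound_of_continuousOn hg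
  exact ⟨C, fun t => (le_abs_self _).trans (hC _ (clamp_mem t))⟩

lemma inner_bds (n : ℕ) (z u : EuclideanSpace ℝ (Fin (n + 1))) (hz : ‖z‖ = 1) (hu : ‖u‖ = 1) :
    -1 ≤ ⟪z, u⟫ ∧ ⟪z, u⟫ ≤ 1 := by
  have := abs_le.1 (abs_real_inner_le_norm z u)
  rwa [hz, hu, mul_one] at this

/-- Bessel with two orthonormal vectors. -/
lemma bessel2 (n : ℕ) (z w u : EuclideanSpace ℝ (Fin (n + 1))) (hz : ‖z‖ = 1) (hw : ‖w‖ = 1)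
    (hu : ‖u‖ = 1) (hzw : ⟪z, w⟫ = 0) : ⟪z, u⟫ ^ 2 + ⟪u, w⟫ ^ 2 ≤ 1 := by
  have h := real_inner_self_nonneg (x := u - ⟪z, u⟫ • z - ⟪u, w⟫ • w)
  have h1 : ⟪u, z⟫ = ⟪z, u⟫ := real_inner_comm _ _
  have h2 : ⟪w, u⟫ = ⟪u, w⟫ := real_inner_comm _ _
  have h3 : ⟪w, z⟫ = 0 := by rw [real_inner_comm, hzw]
  simp only [inner_sub_left, inner_sub_right, inner_smul_left, inner_smul_right, conj_trivial,
    real_inner_self_eq_norm_sq, hz, hw, hu, hzw, h1, h2, h3] at h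
  nlinarith

lemma crit_scalar (n : ℕ) (g : ℝ → ℝ) (hg : ContinuousOn g (Set.Icc (-1) 1)) (r : ℝ)
    (c a z w : EuclideanSpace ℝ (Fin (n + 1))) (ha : ‖a‖ = 1) (hz : ‖z‖ = 1) (hzw : ⟪z, w⟫ = 0)
    (hcrit : (∫ v in gball n c r, g ⟪z, fold n a v⟫ • proj n z (fold n a v) ∂μH[(n:ℝ)]) = 0) :
    ∫ v in gball n c r, clampg g ⟪z, fold n a v⟫ * ⟪fold n a v, w⟫ ∂μH[(n:ℝ)] = 0 := by
  have hgc := clampg_cont g hg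
  obtain ⟨C, hC⟩ := isCompact_Icc.exists_bound_of_continuousOn hg
  have h1 : ∫ v in gball n c r, clampg g ⟪z, fold n a v⟫ • proj n z (fold n a v) ∂μH[(n:ℝ)] = 0 := by
    rw [← hcrit]
    refine setIntegral_congr_fun (gball_meas n c r) fun v hv => ?_
    have hv1 : ‖v‖ = 1 := by simpa [sph] using hv.1
    obtain ⟨hb1, hb2⟩ := inner_bds n z (fold n a v) hz (by rw [fold_norm n a v ha, hv1])
    simp only [clampg_eq g _ hb1 hb2]
  have hfm := fold_meas n a
  have hint : IntegrableOn (fun v => clampg g ⟪z, fold n a v⟫ • proj n z (fold n a v))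
      (sph n) μH[(n:ℝ)] := by
    have hcp : Continuous fun u => clampg g ⟪z, u⟫ • proj n z u := by
      unfold proj; fun_prop
    refine integ n _ (hcp.measurable.comp hfm).stronglyMeasurable (C * 2) fun v hv => ?_
    have hv1 : ‖v‖ = 1 := by simpa [sph] using hv
    have hf1 : ‖fold n a v‖ = 1 := by rw [fold_norm n a v ha, hv1]
    have h2 : ‖proj n z (fold n a v)‖ ≤ 2 := by
      unfold proj
      refine (norm_sub_le _ _).trans ?_
      rw [norm_smul, hz, hf1, Real.norm_eq_abs]
      have := abs_real_inner_le_norm (fold n a v) z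
      rw [hf1, hz] at this
      linarith
    rw [norm_smul]
    have h3 := hC _ (clamp_mem ⟪z, fold n a v⟫)
    exact mul_le_mul h3 h2 (norm_nonneg _) ((norm_nonneg _).trans h3)
  have h2 := (innerSL ℝ w).integral_comp_comm (hint.mono_set (fun v (hv : v ∈ gball n c r) => hv.1))
  rw [h1, map_zero] at h2
  rw [← h2]
  refine setIntegral_congr_fun (gball_meas n c r) fun v hv => ?_
  simp only [innerSL_apply_apply, inner_smul_right, proj, inner_sub_right]
  rw [show ⟪w, z⟫ = 0 by rw [real_inner_comm, hzw], real_inner_comm w]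
  ring

lemma clampg_pos (n : ℕ) (g : ℝ → ℝ) (hg_pos : ∀ t ∈ Set.Ioo (-1:ℝ) 1, 0 < g t)
    (z w u : EuclideanSpace ℝ (Fin (n + 1))) (hz : ‖z‖ = 1) (hw : ‖w‖ = 1)
    (hu : ‖u‖ = 1) (hzw : ⟪z, w⟫ = 0) (h : ⟪u, w⟫ ≠ 0) : 0 < clampg g ⟪z, u⟫ := by
  have h1 := bessel2 n z w u hz hw hu hzw
  have h2 : 0 < ⟪u, w⟫ ^ 2 := by positivity
  have h3 : |⟪z, u⟫| < 1 := by rw [← sq_lt_one_iff_abs_lt_one]; linarith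
  obtain ⟨h4, h5⟩ := abs_lt.1 h3
  rw [clampg_eq g _ h4.le h5.le]
  exact hg_pos _ ⟨h4, h5⟩

/-- Step 1. -/
lemma step1 (n : ℕ) (hn : 2 ≤ n) (g : ℝ → ℝ) (hg : ContinuousOn g (Set.Icc (-1) 1))
    (hg_nonneg : ∀ t ∈ Set.Icc (-1:ℝ) 1, 0 ≤ g t)
    (hg_pos : ∀ t ∈ Set.Ioo (-1:ℝ) 1, 0 < g t)
    (r : ℝ) (hr0 : 0 < r) (hr1 : r < π / 4)
    (p a z u : EuclideanSpace ℝ (Fin (n + 1))) (hp : ‖p‖ = 1) (ha : ‖a‖ = 1) (hz : ‖z‖ = 1)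
    (hua : ⟪u, a⟫ = 0) (hzu : ⟪z, u⟫ = 0) (hpu : 0 < ⟪p, u⟫)
    (hcrit : (∫ v in gball n p r, g ⟪z, fold n a v⟫ • proj n z (fold n a v) ∂μH[(n:ℝ)]) = 0) :
    False := by
  have hu0 : 0 < ‖u‖ := by
    rw [norm_pos_iff]; rintro rfl; simp at hpu
  set w := ‖u‖⁻¹ • u with hw_def
  have hw : ‖w‖ = 1 := by rw [hw_def, norm_smul, norm_inv, norm_norm, inv_mul_cancel₀ hu0.ne']
  have hwa : ⟪w, a⟫ = 0 := by simp [hw_def, inner_smul_left, hua]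
  have hzw : ⟪z, w⟫ = 0 := by simp [hw_def, inner_smul_right, hzu]
  have hpw : 0 < ⟪p, w⟫ := by
    rw [hw_def, inner_smul_right]; positivity
  have h1 := crit_scalar n g hg r p a z w ha hz hzw hcrit
  simp only [fold_inner_orth n a _ w hwa] at h1
  obtain ⟨C, hC⟩ := clampg_bdd g hg
  have hgc := clampg_cont g hg
  refine keyA n hn p w hp hw hpw r hr0 hr1 (fun v => clampg g ⟪z, fold n a v⟫) ?_ C
    (fun v _ => hC _) (fun v _ => hg_nonneg _ (clamp_mem _)) ?_ ?_ h1
  · have hcp : Continuous fun u => clampg g ⟪z, u⟫ := by fun_prop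
    exact hcp.measurable.comp (fold_meas n a)
  · intro v _
    simp only [fold_comm n a w v hwa, refl_inner n z, hzw, mul_zero, sub_zero]
  · intro v hv hvw
    have hv1 : ‖v‖ = 1 := by simpa [sph] using hv
    exact clampg_pos n g hg_pos z w (fold n a v) hz hw (by rw [fold_norm n a v ha, hv1]) hzw
      (by rwa [fold_inner_orth n a _ w hwa])

set_option maxHeartbeats 1000000 in
/-- Step 2. -/
lemma step2 (n : ℕ) (hn : 2 ≤ n) (g : ℝ → ℝ) (hg : ContinuousOn g (Set.Icc (-1) 1))
    (hg_nonneg : ∀ t ∈ Set.Icc (-1:ℝ) 1, 0 ≤ g t)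
    (hg_pos : ∀ t ∈ Set.Ioo (-1:ℝ) 1, 0 < g t)
    (r : ℝ) (hr0 : 0 < r) (hr1 : r < π / 4)
    (c a z e w : EuclideanSpace ℝ (Fin (n + 1))) (ha : ‖a‖ = 1) (hz : ‖z‖ = 1)
    (he : ‖e‖ = 1) (hea : ⟪e, a⟫ = 0) (κ s C S : ℝ) (hκ : 0 < κ) (hs : 0 < s)
    (hκs : κ ^ 2 + s ^ 2 = 1) (hze : z = -κ • a + s • e) (hwe : w = -s • a - κ • e)
    (hC : 0 ≤ C) (hS : 0 ≤ S) (hCS : C ^ 2 + S ^ 2 = 1) (hc : c = -C • a - S • e)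
    (hcrit : ∫ v in gball n c r, clampg g ⟪z, fold n a v⟫ * ⟪fold n a v, w⟫ ∂μH[(n:ℝ)] = 0) :
    False := by
  have hae : ⟪a, e⟫ = 0 := by rw [real_inner_comm, hea]
  have haa : ⟪a, a⟫ = 1 := by rw [real_inner_self_eq_norm_sq, ha]; norm_num
  have hee : ⟪e, e⟫ = 1 := by rw [real_inner_self_eq_norm_sq, he]; norm_num
  have hzw : ⟪z, w⟫ = 0 := by
    simp only [hze, hwe, inner_sub_right, inner_add_left, inner_smul_left, inner_smul_right,
      conj_trivial, haa, hee, hae, hea]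
    ring
  have hw : ‖w‖ = 1 := by
    have : ‖w‖ ^ 2 = 1 := by
      rw [← real_inner_self_eq_norm_sq]
      simp only [hwe, inner_sub_right, inner_sub_left, inner_smul_left, inner_smul_right,
        conj_trivial, haa, hee, hae, hea]
      linarith
    exact (pow_eq_one_iff_of_nonneg (norm_nonneg _) two_ne_zero).1 this
  have hcn : ‖c‖ = 1 := by
    have : ‖c‖ ^ 2 = 1 := by
      rw [← real_inner_self_eq_norm_sq]
      simp only [hc, inner_sub_right, inner_sub_left, inner_smul_left, inner_smul_right,
        conj_trivial, haa, hee, hae, hea]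
      linarith
    exact (pow_eq_one_iff_of_nonneg (norm_nonneg _) two_ne_zero).1 this
  have hcv : ∀ v, ⟪c, v⟫ = -C * ⟪v, a⟫ - S * ⟪v, e⟫ := fun v => by
    simp only [hc, inner_sub_left, inner_smul_left, conj_trivial]
    rw [real_inner_comm a v, real_inner_comm e v]
  have hvw : ∀ v, ⟪v, w⟫ = -s * ⟪v, a⟫ - κ * ⟪v, e⟫ := fun v => by
    simp only [hwe, inner_sub_right, inner_smul_right]
  have hcosr : 0 < cos r := cos_pos_of_mem_Ioo ⟨by linarith [pi_pos], by linarith [pi_pos]⟩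
  have hsinr : 0 < sin r := sin_pos_of_pos_of_lt_pi hr0 (by linarith [pi_pos])
  have hsc : sin r < cos r := by
    rw [← cos_pi_div_two_sub]
    exact Real.strictAntiOn_cos ⟨hr0.le, by linarith [pi_pos]⟩
      ⟨by linarith [pi_pos], by linarith [pi_pos]⟩ (by linarith)
  have hsc2 := sin_sq_add_cos_sq r
  obtain ⟨M, hM⟩ := clampg_bdd g hg
  have hgc := clampg_cont g hg
  have hcp : Continuous fun u => clampg g ⟪z, u⟫ := by fun_prop
  have hB := gball_eq n c hcn r hr0 hr1
  rcases le_or_gt (sin r) S with hcase | hcase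
  · have hneg : ∀ v ∈ gball n c r, ⟪v, e⟫ < 0 := by
      intro v hv
      rw [hB] at hv
      have hv1 : ‖v‖ = 1 := by simpa [sph] using hv.1
      have h1 := hv.2
      rw [hcv] at h1
      obtain ⟨h2, h3⟩ := inner_bds n v a hv1 ha
      by_contra hcon
      push Not at hcon
      have h4 : cos r < C := by nlinarith
      nlinarith
    have hpos : ∀ v ∈ gball n c r, 0 < clampg g ⟪z, fold n a v⟫ * ⟪fold n a v, w⟫ := by
      intro v hv
      have hv1 : ‖v‖ = 1 := by simpa [sph] using hv.1
      have h1 : 0 < ⟪fold n a v, w⟫ := by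
        rw [hvw, fold_inner_orth n a v e hea]
        nlinarith [hneg v hv, fold_nonpos n a v ha]
      exact mul_pos (clampg_pos n g hg_pos z w (fold n a v) hz hw (by rw [fold_norm n a v ha, hv1]) hzw
        h1.ne') h1
    have hint : IntegrableOn (fun v => clampg g ⟪z, fold n a v⟫ * ⟪fold n a v, w⟫)
        (sph n) μH[(n:ℝ)] := by
      have hcp' : Continuous fun u => clampg g ⟪z, u⟫ * ⟪u, w⟫ := by fun_prop
      refine integ n _ (hcp'.measurable.comp (fold_meas n a)).stronglyMeasurable M fun v hv => ?_
      have hv1 : ‖v‖ = 1 := by simpa [sph] using hv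
      have h1 := abs_real_inner_le_norm (fold n a v) w
      rw [fold_norm n a v ha, hv1, hw, mul_one] at h1
      have h2 : 0 ≤ clampg g ⟪z, fold n a v⟫ := hg_nonneg _ (clamp_mem _)
      rw [Real.norm_eq_abs, abs_mul, abs_of_nonneg h2]
      nlinarith [hM ⟪z, fold n a v⟫]
    have h5 : 0 < ∫ v in gball n c r, clampg g ⟪z, fold n a v⟫ * ⟪fold n a v, w⟫ ∂μH[(n:ℝ)] := by
      rw [setIntegral_pos_iff_support_of_nonneg_ae]
      · have hU : IsOpen {v | cos r < ⟪c, v⟫} := isOpen_lt continuous_const (by fun_prop)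
        refine lt_of_lt_of_le (sph_open_pos n _ hU c ?_ (by simpa [sph] using hcn)) (measure_mono ?_)
        · show cos r < ⟪c, c⟫
          rw [real_inner_self_eq_norm_sq, hcn]
          nlinarith
        · rintro u ⟨hu1, hus⟩
          have hmem : u ∈ gball n c r := by rw [hB]; exact ⟨hus, hu1⟩
          exact ⟨(hpos u hmem).ne', hmem⟩
      · exact (ae_restrict_iff' (gball_meas n c r)).2
          (Filter.Eventually.of_forall fun v hv => (hpos v hv).le)
      · exact hint.mono_set (fun v hv => hv.1)
    linarith
  · have hneg : ∀ v ∈ gball n c r, ⟪v, a⟫ < 0 := by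
      intro v hv
      rw [hB] at hv
      have hv1 : ‖v‖ = 1 := by simpa [sph] using hv.1
      have h1 := hv.2
      rw [hcv] at h1
      obtain ⟨h2, h3⟩ := inner_bds n v e hv1 he
      by_contra hcon
      push Not at hcon
      have h4 := mul_nonneg hC hcon
      have h5 := mul_nonneg hS (show 0 ≤ ⟪v, e⟫ + 1 by linarith)
      linarith
    have hcw : 0 < ⟪c, w⟫ := by
      rw [hcv, hwe]
      simp only [inner_sub_left, inner_sub_right, inner_smul_left, inner_smul_right,
        conj_trivial, haa, hee, hae, hea]
      have hC0 : 0 < C := by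
        rcases hC.lt_or_eq with h | h
        · exact h
        · rw [← h] at hCS
          have h6 : S ^ 2 < sin r ^ 2 := pow_lt_pow_left₀ hcase hS two_ne_zero
          have h7 : 0 < cos r ^ 2 := pow_pos hcosr 2
          linarith
      linarith [mul_pos hs hC0, mul_nonneg hκ.le hS]
    have h1 : ∫ v in gball n c r, clampg g ⟪z, v⟫ * ⟪v, w⟫ ∂μH[(n:ℝ)] = 0 := by
      rw [← hcrit]
      refine setIntegral_congr_fun (gball_meas n c r) fun v hv => ?_
      have hf : fold n a v = v := by
        unfold fold
        rw [if_neg (not_lt.2 (hneg v hv).le)]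
      simp only [hf]
    refine keyA n hn c w hcn hw hcw r hr0 hr1 (fun v => clampg g ⟪z, v⟫) hcp.measurable M
      (fun v _ => hM _) (fun v _ => hg_nonneg _ (clamp_mem _)) ?_ ?_ h1
    · intro v _
      simp only [refl_inner n z, hzw, mul_zero, sub_zero]
    · intro v hv hvw
      have hv1 : ‖v‖ = 1 := by simpa [sph] using hv
      exact clampg_pos n g hg_pos z w v hz hw hv1 hzw hvw

lemma crit_refl (n : ℕ) (g : ℝ → ℝ) (r : ℝ) (c a z w : EuclideanSpace ℝ (Fin (n + 1)))
    (ha : ‖a‖ = 1) :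
    ∫ v in gball n (sphRefl n a c) r, clampg g ⟪z, fold n a v⟫ * ⟪fold n a v, w⟫ ∂μH[(n:ℝ)] =
    ∫ v in gball n c r, clampg g ⟪z, fold n a v⟫ * ⟪fold n a v, w⟫ ∂μH[(n:ℝ)] := by
  have h := refl_integral n a ha (fun v => clampg g ⟪z, fold n a v⟫ * ⟪fold n a v, w⟫) (gball n c r)
  simp only [fold_refl n a _ ha] at h
  rw [← h]
  congr 2
  ext v
  have h1 : ⟪sphRefl n a c, v⟫ = ⟪c, sphRefl n a v⟫ := by
    rw [refl_inner, real_inner_comm, refl_inner, real_inner_comm c v]; ring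
  simp only [gball, Set.mem_ofPred_eq, Set.mem_preimage, refl_sph n a v ha, h1]

/-- For `r ∈ (0, π/4)`, antipodal points `p, q = -p ∈ Sⁿ`, and `a, z ∈ Sⁿ`
with `z·a < 0`: if `∫_{B_{p,r}} g(z·F_a v) π_z(F_a v) dv = 0` and
`∫_{B_{q,r}} g(z·F_a v) π_z(F_a v) dv = 0`, then `{z, R_a(z)} = {p, q}`. -/
theorem statement10 (n : ℕ) (hn : 2 ≤ n)
    (g : ℝ → ℝ) (hg_cont : ContinuousOn g (Set.Icc (-1) 1))
    (hg_even : ∀ t, g (-t) = g t)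
    (hg_nonneg : ∀ t ∈ Set.Icc (-1:ℝ) 1, 0 ≤ g t)
    (hg_pos : ∀ t ∈ Set.Ioo (-1:ℝ) 1, 0 < g t)
    (r : ℝ) (hr : r ∈ Set.Ioo 0 (π / 4))
    (p q : EuclideanSpace ℝ (Fin (n + 1))) (hp : p ∈ sph n) (hq : q = -p)
    (a z : EuclideanSpace ℝ (Fin (n + 1))) (ha : a ∈ sph n) (hz : z ∈ sph n)
    (hza : ⟪z, a⟫ < 0)
    (hcritp : (∫ v in gball n p r, g ⟪z, fold n a v⟫ • proj n z (fold n a v) ∂μH[(n:ℝ)]) = 0)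
    (hcritq : (∫ v in gball n q r, g ⟪z, fold n a v⟫ • proj n z (fold n a v) ∂μH[(n:ℝ)]) = 0) :
    ({z, sphRefl n a z} : Set (EuclideanSpace ℝ (Fin (n + 1)))) = {p, q} := by
  have hp1 : ‖p‖ = 1 := by simpa [sph] using hp
  have ha1 : ‖a‖ = 1 := by simpa [sph] using ha
  have hz1 : ‖z‖ = 1 := by simpa [sph] using hz
  have haa : ⟪a, a⟫ = 1 := by rw [real_inner_self_eq_norm_sq, ha1]; norm_num
  have hpp : ⟪p, p⟫ = 1 := by rw [real_inner_self_eq_norm_sq, hp1]; norm_num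
  have hzz : ⟪z, z⟫ = 1 := by rw [real_inner_self_eq_norm_sq, hz1]; norm_num
  obtain ⟨hr0, hr1⟩ := hr
  have hst : ∀ u, ⟪u, a⟫ = 0 → ⟪z, u⟫ = 0 → ⟪p, u⟫ = ⟪u, u⟫ → u = 0 := by
    intro u h1 h2 h3
    by_contra hu
    have h4 : 0 < ⟪u, u⟫ := real_inner_self_pos.2 hu
    exact step1 n hn g hg_cont hg_nonneg hg_pos r hr0 hr1 p a z u hp1 ha1 hz1 h1 h2
      (by rw [h3]; exact h4) hcritp
  by_cases hzeq : z = -a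
  · have hu := hst (p - ⟪p, a⟫ • a) (by simp [inner_sub_left, inner_smul_left, haa, ha1])
      (by simp [hzeq, inner_sub_right, inner_smul_right, haa, ha1, real_inner_comm])
      (by simp only [inner_sub_right, inner_sub_left, inner_smul_right, inner_smul_left, haa,
            conj_trivial, real_inner_comm p a]; ring)
    have hpa : p = ⟪p, a⟫ • a := sub_eq_zero.1 hu
    have hsq : ⟪p, a⟫ ^ 2 = 1 := by
      have : ⟪p, p⟫ = ⟪p, a⟫ ^ 2 := by
        conv_lhs => rw [hpa]
        simp only [inner_smul_right, inner_smul_left, haa, conj_trivial]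
        ring
      rw [← this, hpp]
    have hR : sphRefl n a z = a := by
      simp only [sphRefl, hzeq, inner_neg_left, haa]
      module
    rw [hR, hzeq, hq]
    rcases (sq_eq_sq_iff_eq_or_eq_neg.1 (hsq.trans (one_pow 2).symm)) with h | h
    · rw [h, one_smul] at hpa
      rw [hpa, Set.pair_comm]
    · rw [h, neg_one_smul] at hpa
      rw [hpa, neg_neg]
  · exfalso
    set κ := -⟪z, a⟫ with hκ_def
    have hκ : 0 < κ := by linarith
    have hza' : ⟪z, a⟫ = -κ := by rw [hκ_def]; ring
    have haz' : ⟪a, z⟫ = -κ := by rw [real_inner_comm, hza']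
    set e0 := z + κ • a with he0
    have he0ne : e0 ≠ 0 := by
      intro h
      have h1 : z = -κ • a := by rw [neg_smul]; exact eq_neg_of_add_eq_zero_left h
      have h2 : κ ^ 2 = 1 := by
        have : ⟪z, z⟫ = κ ^ 2 := by
          conv_lhs => rw [h1]
          simp only [inner_smul_right, inner_smul_left, haa, conj_trivial]
          ring
        rw [← this, hzz]
      have h3 : κ = 1 := (pow_eq_one_iff_of_nonneg hκ.le two_ne_zero).1 h2
      rw [h3, neg_one_smul] at h1
      exact hzeq h1
    set s := ‖e0‖ with hs_def
    have hs : 0 < s := norm_pos_iff.2 he0ne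
    have hκs : κ ^ 2 + s ^ 2 = 1 := by
      rw [hs_def, ← real_inner_self_eq_norm_sq, he0]
      simp only [inner_add_left, inner_add_right, inner_smul_right, inner_smul_left, haa,
        conj_trivial, hzz, hza', haz']
      ring
    set e := s⁻¹ • e0 with he_def
    have hse : s • e = e0 := by rw [he_def, smul_smul, mul_inv_cancel₀ hs.ne', one_smul]
    have he : ‖e‖ = 1 := by
      rw [he_def, norm_smul, norm_inv, Real.norm_eq_abs, abs_of_pos hs, ← hs_def,
        inv_mul_cancel₀ hs.ne']
    have hee : ⟪e, e⟫ = 1 := by rw [real_inner_self_eq_norm_sq, he]; norm_num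
    have hea : ⟪e, a⟫ = 0 := by
      rw [he_def, he0]
      simp only [inner_add_left, inner_smul_left, haa, conj_trivial, hza']
      ring
    have hae : ⟪a, e⟫ = 0 := by rw [real_inner_comm, hea]
    have hze : z = -κ • a + s • e := by rw [hse, he0]; module
    have hu := hst (p - ⟪p, a⟫ • a - ⟪p, e⟫ • e)
      (by simp only [inner_sub_left, inner_smul_left, haa, hea, conj_trivial]; ring)
      (by
        simp only [hze, inner_sub_right, inner_add_left, inner_smul_right, inner_smul_left, haa, hea, hae,
            hee, conj_trivial, real_inner_comm p a, real_inner_comm p e]; ring)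
      (by simp only [inner_sub_right, inner_sub_left, inner_smul_right, inner_smul_left, haa, hea, hae,
            hee, conj_trivial, real_inner_comm p a, real_inner_comm p e]; ring)
    have hpd : p = ⟪p, a⟫ • a + ⟪p, e⟫ • e := by
      rw [sub_sub] at hu; exact sub_eq_zero.1 hu
    generalize ⟪p, a⟫ = x at hpd
    generalize ⟪p, e⟫ = y at hpd
    have hxy : x ^ 2 + y ^ 2 = 1 := by
      rw [← hpp, hpd]
      simp only [inner_add_right, inner_add_left, inner_smul_right, inner_smul_left, haa, hea, hae,
            hee, conj_trivial]
      ring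
    set w := -s • a - κ • e with hwe
    have hzw : ⟪z, w⟫ = 0 := by
      rw [hze, hwe]
      simp only [inner_sub_right, inner_add_left, inner_smul_left, inner_smul_right,
        conj_trivial, haa, hee, hae, hea]
      ring
    have hIp := crit_scalar n g hg_cont r p a z w ha1 hz1 hzw hcritp
    have hIq := crit_scalar n g hg_cont r q a z w ha1 hz1 hzw hcritq
    have main : ∀ (c : EuclideanSpace ℝ (Fin (n + 1))) (X Y : ℝ), X ^ 2 + Y ^ 2 = 1 → Y ≤ 0 →
        c = X • a + Y • e →
        ∫ v in gball n c r, clampg g ⟪z, fold n a v⟫ * ⟪fold n a v, w⟫ ∂μH[(n:ℝ)] = 0 → False := by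
      intro c X Y hXY hY hc hI
      rcases le_total X 0 with hX | hX
      · exact step2 n hn g hg_cont hg_nonneg hg_pos r hr0 hr1 c a z e w ha1 hz1 he hea κ s (-X) (-Y)
          hκ hs hκs hze hwe (by linarith) (by linarith) (by linarith) (by rw [hc]; module) hI
      · rw [← crit_refl n g r c a z w ha1] at hI
        refine step2 n hn g hg_cont hg_nonneg hg_pos r hr0 hr1 _ a z e w ha1 hz1 he hea κ s X (-Y)
          hκ hs hκs hze hwe (by linarith) (by linarith) (by linarith) ?_ hI
        have : ⟪c, a⟫ = X := by
          rw [hc]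
          simp only [inner_add_left, inner_smul_left, conj_trivial, haa, hea]
          ring
        rw [sphRefl, this, hc]
        module
    rcases le_total y 0 with hy | hy
    · exact main p x y hxy hy hpd hIp
    · exact main q (-x) (-y) (by linarith) (by linarith) (by rw [hq, hpd]; module) hIq
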